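/- For a complex number s with Re(s) > −3/2, the infinite product E₂(s) = Π_p ( 1 + p^{−s}/(p²(p−1)) − p^{−2s}/(p³(p−1)) ), taken over primes p, converges and defines a holomorphic function on the half-plane Re(s) > −3/2; moreover E₂(−1) = 1 and E₂'(−1) = Σ_p (log p)/(p(p−1)). -/

import Mathlib

/-- The Euler factor `1 + p^{−s}/(p²(p−1)) − p^{−2s}/(p³(p−1))`. -/
noncomputable def eulerFactor (s : ℂ) (p : Nat.Primes) : ℂ :=
  1 + ((p : ℕ) : ℂ) ^ (-s) / (((p : ℕ) : ℂ) ^ 2 * (((p : ℕ) : ℂ) - 1))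
    - ((p : ℕ) : ℂ) ^ (-(2 * s)) / (((p : ℕ) : ℂ) ^ 3 * (((p : ℕ) : ℂ) - 1))

lemma Nat.Primes.two_le_cast (p : Nat.Primes) : (2 : ℝ) ≤ p := mod_cast p.prop.two_le

lemma Nat.Primes.cast_sub_one_ne_zero (p : Nat.Primes) : ((p : ℕ) : ℂ) - 1 ≠ 0 :=
  sub_ne_zero.mpr (mod_cast p.prop.one_lt.ne')

lemma Nat.Primes.norm_cast_sub_one (p : Nat.Primes) : ‖((p : ℕ) : ℂ) - 1‖ = (p : ℝ) - 1 := by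
  rw [← Complex.ofReal_natCast, ← Complex.ofReal_one, ← Complex.ofReal_sub, Complex.norm_real,
    Real.norm_of_nonneg (by linarith [p.two_le_cast])]

lemma norm_cpow_neg_div_le {p : Nat.Primes} {w : ℂ} {τ : ℝ} (h : τ ≤ w.re) (k : ℕ) :
    ‖((p : ℕ) : ℂ) ^ (-w) / (((p : ℕ) : ℂ) ^ k * (((p : ℕ) : ℂ) - 1))‖
      ≤ 2 * (p : ℝ) ^ (-τ - k - 1) := by
  have hp2 := p.two_le_cast
  have hp0 : (0 : ℝ) < p := by linarith
  rw [norm_div, norm_mul, norm_pow, Complex.norm_natCast, p.norm_cast_sub_one,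
    Complex.norm_natCast_cpow_of_pos p.prop.pos, Complex.neg_re,
    Real.rpow_sub hp0, Real.rpow_sub hp0, Real.rpow_natCast, Real.rpow_one]
  calc (p : ℝ) ^ (-w.re) / ((p : ℝ) ^ k * (p - 1))
      ≤ (p : ℝ) ^ (-τ) / ((p : ℝ) ^ k * (p / 2)) := by
        gcongr
        · linarith
        · linarith
    _ = 2 * ((p : ℝ) ^ (-τ) / (p : ℝ) ^ k / p) := by field_simp

lemma hasDerivAt_eulerFactor (s : ℂ) (p : Nat.Primes) :
    HasDerivAt (eulerFactor · p)
      (-(Complex.log p * (p : ℂ) ^ (-s)) / ((p : ℂ) ^ 2 * ((p : ℂ) - 1))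
        + 2 * (Complex.log p * (p : ℂ) ^ (-(2 * s))) / ((p : ℂ) ^ 3 * ((p : ℂ) - 1))) s := by
  have hp : ((p : ℕ) : ℂ) ≠ 0 := mod_cast p.prop.ne_zero
  have h₁ := ((hasDerivAt_id s).neg.const_cpow (c := ((p : ℕ) : ℂ)) (.inl hp)).div_const
    (((p : ℕ) : ℂ) ^ 2 * (((p : ℕ) : ℂ) - 1))
  have h₂ := (((hasDerivAt_id s).const_mul 2).neg.const_cpow (c := ((p : ℕ) : ℂ))
    (.inl hp)).div_const (((p : ℕ) : ℂ) ^ 3 * (((p : ℕ) : ℂ) - 1))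
  refine ((h₁.const_add 1).sub h₂).congr_deriv ?_
  simp only [id, Pi.neg_apply]
  ring

lemma differentiable_eulerFactor (p : Nat.Primes) : Differentiable ℂ (eulerFactor · p) :=
  fun s ↦ (hasDerivAt_eulerFactor s p).differentiableAt

lemma eulerFactor_neg_one (p : Nat.Primes) : eulerFactor (-1) p = 1 := by
  have hp : ((p : ℕ) : ℂ) ≠ 0 := mod_cast p.prop.ne_zero
  have hp1 := p.cast_sub_one_ne_zero
  have h : -(2 * (-1 : ℂ)) = (2 : ℕ) := by norm_num
  rw [eulerFactor, h, Complex.cpow_natCast, neg_neg, Complex.cpow_one]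
  field_simp
  ring

lemma logDeriv_eulerFactor_neg_one (p : Nat.Primes) :
    logDeriv (eulerFactor · p) (-1) = (Real.log p / ((p : ℝ) * ((p : ℝ) - 1)) : ℝ) := by
  have hp : ((p : ℕ) : ℂ) ≠ 0 := mod_cast p.prop.ne_zero
  have hp1 := p.cast_sub_one_ne_zero
  have h : -(2 * (-1 : ℂ)) = (2 : ℕ) := by norm_num
  rw [logDeriv_apply, (hasDerivAt_eulerFactor (-1) p).deriv, eulerFactor_neg_one, h,
    Complex.cpow_natCast, neg_neg, Complex.cpow_one]
  push_cast [Complex.ofReal_log (Nat.cast_nonneg (p : ℕ))]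
  field_simp
  ring

lemma Nat.Primes.summable_log_div :
    Summable fun p : Nat.Primes ↦ Real.log p / ((p : ℝ) * ((p : ℝ) - 1)) := by
  have hs : Summable fun p : Nat.Primes ↦ 4 * (p : ℝ) ^ (-(3 / 2) : ℝ) :=
    (Nat.Primes.summable_rpow.mpr (by norm_num)).mul_left 4
  refine hs.of_nonneg_of_le (fun p ↦ ?_) fun p ↦ ?_
  · have hp2 := p.two_le_cast
    exact div_nonneg (Real.log_natCast_nonneg _) (mul_nonneg (by linarith) (by linarith))
  · have hp2 := p.two_le_cast
    have hp0 : (0 : ℝ) < p := by linarith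
    have hlog := Real.log_le_rpow_div hp0.le (ε := 1 / 2) (by norm_num)
    have hexp : (-(3 / 2) : ℝ) = 1 / 2 - 1 - 1 := by norm_num
    rw [hexp, Real.rpow_sub hp0, Real.rpow_sub hp0, Real.rpow_one]
    calc Real.log p / ((p : ℝ) * (p - 1))
        ≤ ((p : ℝ) ^ (1 / 2 : ℝ) / (1 / 2)) / (p * (p / 2)) := by
          gcongr
          linarith
      _ = 4 * ((p : ℝ) ^ (1 / 2 : ℝ) / p / p) := by
          field_simp
          norm_num

lemma hasProdLocallyUniformlyOn_eulerFactor {σ : ℝ} (hσ : -(3 / 2) < σ) :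
    HasProdLocallyUniformlyOn (fun p s ↦ eulerFactor s p) (fun s ↦ ∏' p, eulerFactor s p)
      {s : ℂ | σ < s.re} := by
  have hu : Summable fun p : Nat.Primes ↦
      2 * (p : ℝ) ^ (-σ - (2 : ℕ) - 1) + 2 * (p : ℝ) ^ (-(2 * σ) - (3 : ℕ) - 1) :=
    ((Nat.Primes.summable_rpow.mpr (by norm_num; linarith)).mul_left 2).add
      ((Nat.Primes.summable_rpow.mpr (by norm_num; linarith)).mul_left 2)
  have key := hu.hasProdLocallyUniformlyOn_one_add
    (f := fun p s ↦ eulerFactor s p - 1) (isOpen_lt continuous_const Complex.continuous_re)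
    (.of_forall fun p s (hs : σ < s.re) ↦ ?_)
    (fun p ↦ ((differentiable_eulerFactor p).sub_const 1).continuous.continuousOn)
  · simpa only [add_sub_cancel] using key
  · rw [eulerFactor, add_sub_assoc, add_sub_cancel_left]
    refine (norm_sub_le _ _).trans (add_le_add (norm_cpow_neg_div_le hs.le 2)
      (norm_cpow_neg_div_le ?_ 3))
    simpa using hs.le

theorem statement14 :
    ∃ E₂ : ℂ → ℂ,
      (∀ s : ℂ, -(3/2 : ℝ) < s.re →
        Multipliable (eulerFactor s) ∧ E₂ s = ∏' p : Nat.Primes, eulerFactor s p) ∧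
      DifferentiableOn ℂ E₂ {s : ℂ | -(3/2 : ℝ) < s.re} ∧
      E₂ (-1) = 1 ∧
      deriv E₂ (-1)
        = ((∑' p : Nat.Primes, Real.log p / ((p : ℝ) * ((p : ℝ) - 1)) : ℝ) : ℂ) := by
  have hopen (σ : ℝ) : IsOpen {s : ℂ | σ < s.re} :=
    isOpen_lt continuous_const Complex.continuous_re
  have hone : ∏' p, eulerFactor (-1) p = 1 := by simp [eulerFactor_neg_one]
  refine ⟨fun s ↦ ∏' p, eulerFactor s p, fun s hs ↦ ⟨?_, rfl⟩, fun s hs ↦ ?_, hone, ?_⟩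
  · obtain ⟨σ, hσ, hσs⟩ := exists_between hs
    exact ((hasProdLocallyUniformlyOn_eulerFactor hσ).hasProd hσs).multipliable
  · obtain ⟨σ, hσ, hσs⟩ := exists_between (show -(3 / 2 : ℝ) < s.re from hs)
    have hd := (hasProdLocallyUniformlyOn_iff_tendstoLocallyUniformlyOn.mp
      (hasProdLocallyUniformlyOn_eulerFactor hσ)).differentiableOn
      (.of_forall fun t ↦ DifferentiableOn.fun_finsetProd fun p _ ↦
        (differentiable_eulerFactor p).differentiableOn) (hopen σ)
    exact (hd.differentiableAt ((hopen σ).mem_nhds hσs)).differentiableWithinAt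
  · have hlog := logDeriv_tprod_eq_tsum (hopen (-(5 / 4))) (x := -1)
      (f := fun p s ↦ eulerFactor s p) (by norm_num) (fun p ↦ by simp [eulerFactor_neg_one])
      (fun p ↦ (differentiable_eulerFactor p).differentiableOn)
      (by simpa only [logDeriv_eulerFactor_neg_one, Complex.summable_ofReal]
        using Nat.Primes.summable_log_div)
      ⟨_, hasProdLocallyUniformlyOn_eulerFactor (by norm_num)⟩ (by simp [hone])
    rw [logDeriv_apply, hone, div_one] at hlog
    rw [hlog, Complex.ofReal_tsum]
    exact tsum_congr logDeriv_eulerFactor_neg_one
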